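/- Let 𝐗, 𝐘, Z be pairwise disjoint node sets in a DAG D with 𝐗 and 𝐘 nonempty. If Z satisfies the adjustment criterion relative to (𝐗,𝐘) in D, then for every strictly positive joint probability mass function f consistent with the causal DAG D and all assignments x, y: f(y | do(x)) = f(y | x) when Z = ∅, and f(y | do(x)) = Σ_z f(y | x, z) f(z) otherwise; that is, Z is an adjustment set relative to (𝐗,𝐘) in D. -/

import Mathlib

attribute [local instance] Classical.propDecidable

/-- A finite directed acyclic graph on vertex type `V`. -/
structure DAG (V : Type) [Fintype V] [DecidableEq V] where
  /-- the edge relation: `Edge a b` means there is a directed edge `a → b` -/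
  Edge : V → V → Prop
  /-- there are no directed cycles -/
  acyclic : ∀ v, ¬ Relation.TransGen Edge v v

namespace DAG

variable {V : Type} [Fintype V] [DecidableEq V]

/-- two nodes are adjacent if they are joined by an edge in either direction -/
def Adj (D : DAG V) (a b : V) : Prop := D.Edge a b ∨ D.Edge b a

/-- `p` is a path from `x` to `y`: a list of distinct nodes, consecutive ones adjacent,
starting at `x` and ending at `y`. -/
def IsPathFrom (D : DAG V) (p : List V) (x y : V) : Prop :=
  p.Nodup ∧ p.Chain' D.Adj ∧ p.head? = some x ∧ p.getLast? = some y

/-- a causal (directed) path: all edges point forward -/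
def IsCausal (D : DAG V) (p : List V) : Prop := p.Chain' D.Edge

/-- descendants of a set of nodes (every node is its own descendant) -/
def Desc (D : DAG V) (S : Set V) : Set V :=
  {v | ∃ w ∈ S, Relation.ReflTransGen D.Edge w v}

/-- ancestors of a set of nodes (every node is its own ancestor) -/
def Anc (D : DAG V) (S : Set V) : Set V :=
  {v | ∃ w ∈ S, Relation.ReflTransGen D.Edge v w}

/-- `w` is a collider on the path `p`: both edges of `p` at `w` point into `w` -/
def IsColliderOn (D : DAG V) (p : List V) (w : V) : Prop :=
  ∃ a b, [a, w, b] <:+: p ∧ D.Edge a w ∧ D.Edge b w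

/-- `w` is a non-collider on `p`: a non-endpoint node of `p` that is not a collider on `p` -/
def IsNonColliderOn (D : DAG V) (p : List V) (w : V) : Prop :=
  (∃ a b, [a, w, b] <:+: p) ∧ ¬ D.IsColliderOn p w

/-- `Z` blocks the path `p`: some non-collider on `p` is in `Z`, or some collider on `p`
has no descendant in `Z`.  Otherwise `p` is d-connecting given `Z`. -/
def Blocks (D : DAG V) (Z : Set V) (p : List V) : Prop :=
  (∃ w, D.IsNonColliderOn p w ∧ w ∈ Z) ∨
  (∃ w, D.IsColliderOn p w ∧ D.Desc {w} ∩ Z = ∅)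

/-- `p` is a proper causal path from `X` to `Y` -/
def ProperCausalPath (D : DAG V) (X Y : Set V) (p : List V) : Prop :=
  (∃ x ∈ X, ∃ y ∈ Y, D.IsPathFrom p x y) ∧ (∀ v ∈ p.tail, v ∉ X) ∧ D.IsCausal p

/-- `p` is a proper non-causal path from `X` to `Y` -/
def ProperNonCausalPath (D : DAG V) (X Y : Set V) (p : List V) : Prop :=
  (∃ x ∈ X, ∃ y ∈ Y, D.IsPathFrom p x y) ∧ (∀ v ∈ p.tail, v ∉ X) ∧ ¬ D.IsCausal p

/-- the forbidden set: all descendants of nodes `W ∉ X` lying on a proper causal path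
from `X` to `Y` -/
def Forb (D : DAG V) (X Y : Set V) : Set V :=
  {v | ∃ p w, D.ProperCausalPath X Y p ∧ w ∈ p ∧ w ∉ X ∧
    Relation.ReflTransGen D.Edge w v}

/-- the adjustment criterion of Shpitser et al. / van der Zander et al. -/
def SatisfiesAC (D : DAG V) (X Y Z : Set V) : Prop :=
  Z ∩ D.Forb X Y = ∅ ∧ ∀ p, D.ProperNonCausalPath X Y p → D.Blocks Z p

/-- the constructive set `Adjust(X,Y,D)` -/
def AdjustSet (D : DAG V) (X Y : Set V) : Set V :=
  D.Anc (X ∪ Y) \ (X ∪ Y ∪ D.Forb X Y)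

/-- `Z` d-separates `X` and `Y` in `D`: `Z` blocks every path from `X` to `Y` -/
def DSep (D : DAG V) (X Y Z : Set V) : Prop :=
  ∀ x ∈ X, ∀ y ∈ Y, ∀ p, D.IsPathFrom p x y → D.Blocks Z p

/-- `p` is a back-door path from `x`: its first edge points into `x` -/
def IsBackdoorFrom (D : DAG V) (p : List V) (x : V) : Prop :=
  ∃ b rest, p = x :: b :: rest ∧ D.Edge b x

/-- Pearl's back-door criterion -/
def BackdoorCriterion (D : DAG V) (X Y Z : Set V) : Prop :=
  Z ∩ D.Desc X = ∅ ∧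
  ∀ x ∈ X, ∀ y ∈ Y, ∀ p, D.IsPathFrom p x y → D.IsBackdoorFrom p x → D.Blocks Z p

/-- the generalized back-door criterion of Maathuis and Colombo -/
def GenBackdoorCriterion (D : DAG V) (X Y Z : Set V) : Prop :=
  Z ∩ D.Desc X = ∅ ∧
  ∀ x ∈ X, ∀ y ∈ Y, ∀ p, D.IsPathFrom p x y → D.IsBackdoorFrom p x →
    D.Blocks ((Z ∪ X) \ {x}) p

end DAG

namespace DAG

variable {V : Type} [Fintype V] [DecidableEq V]

section PMF

variable {A : Type} [Fintype A] [DecidableEq A]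

/-- the marginal probability of the event `{w | w = v on S}` under the pmf `f` -/
noncomputable def marg (f : (V → A) → ℝ) (S : Set V) (v : V → A) : ℝ :=
  ∑ w : V → A, if ∀ i ∈ S, w i = v i then f w else 0

/-- the conditional probability `f(s | t)` of the values of `v` on `S` given those on `T` -/
noncomputable def condP (f : (V → A) → ℝ) (S T : Set V) (v : V → A) : ℝ :=
  marg f (S ∪ T) v / marg f T v

/-- the parents of a node -/
def parents (D : DAG V) (i : V) : Set V := {j | D.Edge j i}

/-- `f` is a strictly positive joint pmf consistent with the causal DAG `D`:
it is positive, sums to one, and factorizes according to `D`. -/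
def IsConsistent (D : DAG V) (f : (V → A) → ℝ) : Prop :=
  (∀ v, 0 < f v) ∧ (∑ v : V → A, f v = 1) ∧
  (∀ v, f v = ∏ i : V, condP f {i} (D.parents i) v)

/-- the interventional pmf `f(v | do(X = x))`, defined by truncated factorization -/
noncomputable def doPMF (D : DAG V) (f : (V → A) → ℝ) (X : Set V) (x : V → A)
    (v : V → A) : ℝ :=
  if ∀ i ∈ X, v i = x i then
    ∏ i : V, if i ∈ X then 1 else condP f {i} (D.parents i) v
  else 0

/-- the adjustment formula `∑_z f(y | x, z) f(z)`, where the values of `X` and `Y`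
are read off from the assignment `a` (coordinates outside `Z` are pinned to `a`) -/
noncomputable def adjFormula (f : (V → A) → ℝ) (X Y Z : Set V) (a : V → A) : ℝ :=
  ∑ w : V → A, if ∀ i, i ∉ Z → w i = a i then condP f Y (X ∪ Z) w * marg f Z w else 0

end PMF

end DAG

namespace DAG

/-- The assignment `v` with the coordinates in `X` reset to those of `a`. -/
noncomputable def resetOn {ι α : Type*} (X : Set ι) (a v : ι → α) : ι → α :=
  fun j => if j ∈ X then a j else v j

theorem resetOn_eq_self {ι α : Type*} {X : Set ι} {a v : ι → α}
    (h : ∀ i ∈ X, v i = a i) : resetOn X a v = v := by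
  funext j
  unfold resetOn
  split_ifs with hj
  exacts [(h j hj).symm, rfl]

theorem resetOn_update {ι α : Type*} [DecidableEq ι] {X : Set ι} {a v : ι → α} {i : ι}
    (hi : i ∉ X) (b : α) :
    resetOn X a (Function.update v i b) = Function.update (resetOn X a v) i b := by
  funext j
  unfold resetOn
  by_cases hji : j = i
  · subst hji; simp [hi]
  · simp [Function.update_of_ne hji]

variable {V : Type} [Fintype V] [DecidableEq V]

section Marginals

variable {A : Type} [Fintype A] [DecidableEq A]

theorem ite_eq_ite_of_iff {α : Type*} {b c : Prop} {_ : Decidable b} {_ : Decidable c}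
    {x y z : α} (h : b ↔ c) (hxy : b → x = y) : ite b x z = ite c y z := by
  by_cases hb : b
  · rw [if_pos hb, if_pos (h.1 hb), hxy hb]
  · rw [if_neg hb, if_neg fun hc => hb (h.2 hc)]

theorem sum_ite_eq_sum_ite {ι κ : Type*} [Fintype ι] [Fintype κ] {p : ι → Prop} {q : κ → Prop}
    {_ : ∀ a, Decidable (p a)} {_ : ∀ b, Decidable (q b)} {f : ι → ℝ} {g : κ → ℝ}
    (i : ι → κ) (j : κ → ι) (hi : ∀ a, p a → q (i a)) (hj : ∀ b, q b → p (j b))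
    (left_inv : ∀ a, p a → j (i a) = a) (right_inv : ∀ b, q b → i (j b) = b)
    (h : ∀ a, p a → f a = g (i a)) :
    ∑ a, (if p a then f a else 0) = ∑ b, if q b then g b else 0 := by
  rw [← Finset.sum_filter, ← Finset.sum_filter]
  refine Finset.sum_nbij' i j ?_ ?_ ?_ ?_ ?_ <;> simpa

theorem ite_mul_ite_eq_ite_and {b c : Prop} {_ : Decidable b} {_ : Decidable c} (x y : ℝ) :
    (if b then x else 0) * (if c then y else 0) = if b ∧ c then x * y else 0 := by
  by_cases hb : b <;> by_cases hc : c <;> simp [hb, hc]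

/-- `φ` only reads the coordinates in `S`. -/
def DependsOnCoords (φ : (V → A) → ℝ) (S : Set V) : Prop :=
  ∀ v w : V → A, (∀ j ∈ S, v j = w j) → φ v = φ w

theorem marg_dependsOnCoords (f : (V → A) → ℝ) (S : Set V) :
    DependsOnCoords (marg f S) S := by
  intro v w h
  unfold marg
  refine Finset.sum_congr rfl fun u _ => ?_
  have : (∀ i ∈ S, u i = v i) ↔ ∀ i ∈ S, u i = w i :=
    forall₂_congr fun i hi => by rw [h i hi]
  simp only [this]

theorem condP_dependsOnCoords (f : (V → A) → ℝ) (S T : Set V) :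
    DependsOnCoords (condP f S T) (S ∪ T) := by
  intro v w h
  unfold condP
  rw [marg_dependsOnCoords f (S ∪ T) v w h,
    marg_dependsOnCoords f T v w fun j hj => h j (Or.inr hj)]

theorem marg_pos {f : (V → A) → ℝ} (hf : ∀ v, 0 < f v) (S : Set V) (v : V → A) :
    0 < marg f S v := by
  unfold marg
  refine Finset.sum_pos' (fun w _ => ?_) ⟨v, Finset.mem_univ _, by simpa using hf v⟩
  split_ifs
  exacts [(hf w).le, le_rfl]

theorem marg_univ (f : (V → A) → ℝ) (v : V → A) : marg f Set.univ v = f v := by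
  unfold marg
  rw [Finset.sum_eq_single v]
  · simp
  · intro w _ hw
    rw [if_neg]
    exact fun h => hw (funext fun i => h i trivial)
  · simp

theorem marg_marg (f : (V → A) → ℝ) {S T : Set V} (hST : S ⊆ T) (v : V → A) :
    marg (marg f T) (T \ S)ᶜ v = marg f S v := by
  unfold marg
  trans ∑ w : V → A, ∑ u : V → A,
    if (∀ i ∈ (T \ S)ᶜ, w i = v i) ∧ ∀ i ∈ T, u i = w i then f u else 0
  · refine Finset.sum_congr rfl fun w _ => ?_
    by_cases h : ∀ i ∈ (T \ S)ᶜ, w i = v i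
    · rw [if_pos h]
      exact Finset.sum_congr rfl fun u _ =>
        ite_eq_ite_of_iff (and_iff_right h).symm fun _ => rfl
    · rw [if_neg h]
      exact (Finset.sum_eq_zero fun u _ => if_neg fun h' => h h'.1).symm
  rw [Finset.sum_comm]
  refine Finset.sum_congr rfl fun u _ => ?_
  rw [Finset.sum_eq_single (fun i => if i ∈ T \ S then u i else v i)]
  · refine ite_eq_ite_of_iff ⟨?_, ?_⟩ fun _ => rfl
    · rintro ⟨-, h⟩ i hi
      simpa [hi] using h i (hST hi)
    · intro h
      refine ⟨fun i hi => if_neg hi, fun i hi => ?_⟩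
      by_cases hS : i ∈ S
      · simp [hS, h i hS]
      · simp [hi, hS]
  · intro w _ hw
    rw [if_neg]
    rintro ⟨h1, h2⟩
    refine hw (funext fun i => ?_)
    by_cases hi : i ∈ T \ S
    · simp only [hi, if_true]; exact (h2 i hi.1).symm
    · simp only [hi, if_false]; exact h1 i hi
  · simp

theorem sum_marg_insert (f : (V → A) → ℝ) {i : V} {S : Set V} (hi : i ∉ S) (v : V → A) :
    ∑ b, marg f (insert i S) (Function.update v i b) = marg f S v := by
  unfold marg
  rw [Finset.sum_comm]
  refine Finset.sum_congr rfl fun w _ => ?_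
  rw [Finset.sum_eq_single (w i)]
  · refine ite_eq_ite_of_iff ⟨fun h j hj => ?_, fun h j hj => ?_⟩ fun _ => rfl
    · have := h j (Or.inr hj)
      rwa [Function.update_of_ne (by rintro rfl; exact hi hj)] at this
    · rcases hj with rfl | hj
      · simp
      · rw [Function.update_of_ne (by rintro rfl; exact hi hj)]
        exact h j hj
  · intro b _ hb
    rw [if_neg]
    intro h
    have := h i (Or.inl rfl)
    rw [Function.update_self] at this
    exact hb this.symm
  · simp

theorem marg_congr_of_subset {f g : (V → A) → ℝ} {S T : Set V} (hST : S ⊆ T)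
    (h : ∀ v, marg f T v = marg g T v) (v : V → A) : marg f S v = marg g S v := by
  rw [← marg_marg f hST, ← marg_marg g hST, funext h]

theorem marg_mul (φ ψ : (V → A) → ℝ) {R₁ R₂ S₁ S₂ : Set V}
    (hφ : DependsOnCoords φ S₁) (hψ : DependsOnCoords ψ S₂)
    (h₁ : Disjoint R₁ S₂) (h₂ : Disjoint R₂ S₁) (h : Disjoint R₁ R₂) (v : V → A) :
    marg (fun w => φ w * ψ w) (R₁ ∪ R₂)ᶜ v = marg φ R₁ᶜ v * marg ψ R₂ᶜ v := by
  have d1 := fun j (hj : j ∈ _) => Set.disjoint_left.1 h₁ hj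
  have d2 := fun j (hj : j ∈ _) => Set.disjoint_left.1 h₂ hj
  have d := fun j (hj : j ∈ _) => Set.disjoint_left.1 h hj
  unfold marg
  rw [Finset.sum_mul_sum, ← Finset.sum_product', Finset.univ_product_univ]
  simp_rw [ite_mul_ite_eq_ite_and]
  refine sum_ite_eq_sum_ite
    (fun w => (fun i => if i ∈ R₁ then w i else v i, fun i => if i ∈ R₂ then w i else v i))
    (fun q i => if i ∈ R₁ then q.1 i else q.2 i) (fun w _ => ?_) (fun q hq i hi => ?_)
    (fun w hw => funext fun i => ?_)
    (fun q hq => Prod.ext (funext fun i => ?_) (funext fun i => ?_)) fun w hw => ?_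
  · exact ⟨fun i hi => if_neg hi, fun i hi => if_neg hi⟩
  · rw [Set.mem_compl_iff, Set.mem_union, not_or] at hi
    exact (if_neg hi.1).trans (hq.2 i hi.2)
  · by_cases hi1 : i ∈ R₁
    · simp [hi1]
    · by_cases hi2 : i ∈ R₂
      · simp [hi1, hi2]
      · simp [hi1, hi2, hw i (by simp [hi1, hi2])]
  · by_cases hi1 : i ∈ R₁
    · simp [hi1]
    · simp [hi1, hq.1 i hi1]
  · by_cases hi2 : i ∈ R₂
    · have hi1 : i ∉ R₁ := fun hi => d i hi hi2
      simp [hi1, hi2]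
    · simp [hi2, hq.2 i hi2]
  · dsimp only
    congr 1
    · refine hφ _ _ fun j hj => ?_
      by_cases hj1 : j ∈ R₁
      · simp [hj1]
      · have hj2 : j ∉ R₂ := fun hj2 => d2 j hj2 hj
        simp [hj1, hw j (by simp [hj1, hj2])]
    · refine hψ _ _ fun j hj => ?_
      by_cases hj2 : j ∈ R₂
      · simp [hj2]
      · have hj1 : j ∉ R₁ := fun hj1 => d1 j hj1 hj
        simp [hj2, hw j (by simp [hj1, hj2])]

end Marginals

section Kernels

variable {A : Type} [Fintype A] [DecidableEq A]

/-- The family of a node: the node together with its parents. -/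
def family (D : DAG V) (i : V) : Set V := {i} ∪ D.parents i

/-- `K i` is, for every node `i`, a conditional pmf of node `i` given its parents. -/
structure IsKernelFamily (D : DAG V) (K : V → (V → A) → ℝ) : Prop where
  local_family : ∀ i, DependsOnCoords (K i) (D.family i)
  sum_update : ∀ i v, ∑ b, K i (Function.update v i b) = 1

/-- `S` contains all parents of its members. -/
def IsAncestral (D : DAG V) (S : Set V) : Prop := ∀ i ∈ S, D.parents i ⊆ S

theorem wellFounded_edge (D : DAG V) : WellFounded D.Edge := by
  have : Std.Irrefl (Relation.TransGen D.Edge) := ⟨D.acyclic⟩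
  exact Subrelation.wf (fun h => Relation.TransGen.single h)
    (Finite.wellFounded_of_trans_of_irrefl (Relation.TransGen D.Edge))

theorem edge_asymm (D : DAG V) {a b : V} (h : D.Edge a b) : ¬ D.Edge b a :=
  fun h' => D.acyclic a (.tail (.single h) h')

theorem IsKernelFamily.condP (D : DAG V) {f : (V → A) → ℝ} (hf : ∀ v, 0 < f v) :
    D.IsKernelFamily fun i => condP f {i} (D.parents i) where
  local_family i := condP_dependsOnCoords f _ _
  sum_update i v := by
    have hi : i ∉ D.parents i := fun h => D.acyclic i (.single h)
    have h : ∀ b, DAG.condP f {i} (D.parents i) (Function.update v i b) =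
        marg f (insert i (D.parents i)) (Function.update v i b) / marg f (D.parents i) v := by
      intro b
      unfold DAG.condP
      rw [Set.singleton_union]
      congr 1
      refine marg_dependsOnCoords f _ _ _ fun j hj => ?_
      rw [Function.update_of_ne (by rintro rfl; exact hi hj)]
    rw [Finset.sum_congr rfl fun b _ => h b, ← Finset.sum_div, sum_marg_insert f hi]
    exact div_self (marg_pos hf _ _).ne'

theorem IsKernelFamily.marg_prod {D : DAG V} {K : V → (V → A) → ℝ}
    (hK : D.IsKernelFamily K) {S : Set V} (hS : D.IsAncestral S) (v : V → A) :
    marg (fun w => ∏ i, K i w) S v = ∏ i, if i ∈ S then K i v else 1 := by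
  induction hn : Sᶜ.ncard generalizing S v with
  | zero =>
    obtain rfl : S = Set.univ := by
      rwa [Set.ncard_eq_zero, Set.compl_empty_iff] at hn
    rw [marg_univ]
    simp
  | succ n ih =>
    have hne : Sᶜ.Nonempty := by
      rw [← Set.ncard_pos]; omega
    obtain ⟨i, hi, hmin⟩ := D.wellFounded_edge.has_min _ hne
    have hi' : i ∉ S := hi
    have hS' : D.IsAncestral (insert i S) := by
      rintro j (rfl | hj) k hk
      · by_contra hkS
        exact hmin k (fun h => hkS (Or.inr h)) hk
      · exact Or.inr (hS j hj hk)
    have hcard : ((insert i S)ᶜ).ncard = n := by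
      have : (insert i S)ᶜ = Sᶜ \ {i} := by ext j; simp [and_comm]
      rw [this, Set.ncard_sdiff_singleton_of_mem hi, hn]; rfl
    rw [← sum_marg_insert _ hi' v]
    have h : ∀ b, marg (fun w => ∏ i, K i w) (insert i S) (Function.update v i b) =
        K i (Function.update v i b) * ∏ j, if j ∈ S then K j v else 1 := by
      intro b
      rw [ih hS' _ hcard, ← Finset.mul_prod_erase _ _ (Finset.mem_univ i),
        ← Finset.mul_prod_erase (Finset.univ) (fun j => if j ∈ S then K j v else 1)
          (Finset.mem_univ i), if_pos (Set.mem_insert i S), if_neg hi', one_mul]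
      congr 1
      refine Finset.prod_congr rfl fun j hj => ?_
      have hji : j ≠ i := Finset.ne_of_mem_erase hj
      by_cases hjS : j ∈ S
      · rw [if_pos (Set.mem_insert_of_mem i hjS), if_pos hjS]
        refine hK.local_family j _ _ fun k hk => ?_
        rw [Function.update_of_ne]
        rintro rfl
        rcases hk with rfl | hk
        · exact hi' hjS
        · exact hi' (hS j hjS hk)
      · rw [if_neg hjS, if_neg (by rintro (h | h) <;> contradiction)]
    rw [Finset.sum_congr rfl fun b _ => h b, ← Finset.sum_mul, hK.sum_update, one_mul]

theorem isAncestral_anc (D : DAG V) (S : Set V) : D.IsAncestral (D.Anc S) := by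
  rintro i ⟨w, hw, h⟩ j hj
  exact ⟨w, hw, .head hj h⟩

theorem subset_anc (D : DAG V) (S : Set V) : S ⊆ D.Anc S := fun v hv => ⟨v, hv, .refl⟩

/-- If no family inside an ancestral set meets both `U` and the complement of `U ∪ Z`, then the
two sides of that cut are conditionally independent given `Z`. -/
theorem IsKernelFamily.marg_mul_marg_of_cut {D : DAG V} {K : V → (V → A) → ℝ}
    (hK : D.IsKernelFamily K) {B U X Y Z : Set V} (hB : D.IsAncestral B)
    (hXB : X ⊆ B) (hYB : Y ⊆ B) (hZB : Z ⊆ B)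
    (hXU : Disjoint X U) (hYU : Y ⊆ U)
    (hcut : ∀ i ∈ B, (D.family i ∩ U).Nonempty → D.family i ⊆ U ∪ Z) (v : V → A) :
    marg (fun w => ∏ i, K i w) (Y ∪ (X ∪ Z)) v * marg (fun w => ∏ i, K i w) Z v =
      marg (fun w => ∏ i, K i w) (X ∪ Z) v * marg (fun w => ∏ i, K i w) (Y ∪ Z) v := by
  set φ : (V → A) → ℝ := fun w => ∏ i, if i ∈ B ∧ (D.family i ∩ U).Nonempty then K i w else 1
    with hφdef
  set ψ : (V → A) → ℝ := fun w => ∏ i, if i ∈ B ∧ ¬ (D.family i ∩ U).Nonempty then K i w else 1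
    with hψdef
  have hφ : DependsOnCoords φ (U ∪ Z) := by
    intro v w h
    refine Finset.prod_congr rfl fun i _ => ?_
    split_ifs with hi
    · exact hK.local_family i v w fun j hj => h j (hcut i hi.1 hi.2 hj)
    · rfl
  have hψ : DependsOnCoords ψ Uᶜ := by
    intro v w h
    refine Finset.prod_congr rfl fun i _ => ?_
    split_ifs with hi
    · exact hK.local_family i v w fun j hj => h j fun hjU => hi.2 ⟨j, hj, hjU⟩
    · rfl
  have key : ∀ T, Z ⊆ T → T ⊆ B → marg (fun w => ∏ i, K i w) T v =
      marg φ ((B \ T) ∩ U)ᶜ v * marg ψ ((B \ T) \ U)ᶜ v := by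
    intro T hZT hTB
    rw [← marg_marg _ hTB, ← marg_mul φ ψ hφ hψ, Set.inter_union_sdiff]
    · congr 1
      funext w
      rw [hK.marg_prod hB, hφdef, hψdef, ← Finset.prod_mul_distrib]
      refine Finset.prod_congr rfl fun i _ => ?_
      by_cases h1 : i ∈ B <;> by_cases h2 : (D.family i ∩ U).Nonempty <;> simp [h1, h2]
    · exact Set.disjoint_left.2 fun j hj hj' => hj' hj.2
    · refine Set.disjoint_left.2 fun j hj hj' => ?_
      rcases hj' with h | h
      exacts [hj.2 h, hj.1.2 (hZT h)]
    · exact Set.disjoint_left.2 fun j hj hj' => hj'.2 hj.2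
  have dX : ∀ j ∈ X, j ∉ U := fun j hj => Set.disjoint_left.1 hXU hj
  rw [key (Y ∪ (X ∪ Z)) (fun j h => Or.inr (Or.inr h))
      (Set.union_subset hYB (Set.union_subset hXB hZB)),
    key Z le_rfl hZB, key (X ∪ Z) Set.subset_union_right (Set.union_subset hXB hZB),
    key (Y ∪ Z) Set.subset_union_right (Set.union_subset hYB hZB)]
  have e1 : (B \ (Y ∪ (X ∪ Z))) ∩ U = (B \ (Y ∪ Z)) ∩ U := by
    ext j
    have := dX j
    simp only [Set.mem_inter_iff, Set.mem_sdiff, Set.mem_union]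
    tauto
  have e2 : (B \ (X ∪ Z)) ∩ U = (B \ Z) ∩ U := by
    ext j
    have := dX j
    simp only [Set.mem_inter_iff, Set.mem_sdiff, Set.mem_union]
    tauto
  have e3 : (B \ (Y ∪ (X ∪ Z))) \ U = (B \ (X ∪ Z)) \ U := by
    ext j
    have := @hYU j
    simp only [Set.mem_sdiff, Set.mem_union]
    tauto
  have e4 : (B \ (Y ∪ Z)) \ U = (B \ Z) \ U := by
    ext j
    have := @hYU j
    simp only [Set.mem_sdiff, Set.mem_union]
    tauto
  rw [e1, e2, e3, e4]
  ring

end Kernels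

section Walks

/-- Passing through `w` from `a` to `b` is not blocked by `Z`. -/
def OpenAt (D : DAG V) (Z : Set V) (a w b : V) : Prop :=
  (D.Edge a w ∧ D.Edge b w → w ∈ D.Anc Z) ∧ (¬ (D.Edge a w ∧ D.Edge b w) → w ∉ Z)

/-- `p` is a walk, possibly with repeated nodes, that is d-connecting given `Z`. -/
def IsOpenWalk (D : DAG V) (Z : Set V) (p : List V) : Prop :=
  p.IsChain D.Adj ∧ ∀ a w b, [a, w, b] <:+: p → D.OpenAt Z a w b

variable {D : DAG V} {X Y Z : Set V}

theorem IsOpenWalk.subwalk {p q : List V} (hp : D.IsOpenWalk Z p) (h : q <:+: p) :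
    D.IsOpenWalk Z q :=
  ⟨by obtain ⟨s, t, rfl⟩ := h; exact hp.1.left_of_append.right_of_append,
    fun a w b h' => hp.2 a w b (h'.trans h)⟩

theorem isOpenWalk_singleton (v : V) : D.IsOpenWalk Z [v] := by
  refine ⟨.singleton v, fun a w b h => ?_⟩
  have := h.length_le
  simp at this

theorem IsOpenWalk.cons {c v : V} {p : List V} (hp : D.IsOpenWalk Z (v :: p))
    (hcv : D.Adj c v) (h : ∀ u, p.head? = some u → D.OpenAt Z c v u) :
    D.IsOpenWalk Z (c :: v :: p) := by
  refine ⟨List.isChain_cons_cons.2 ⟨hcv, hp.1⟩, fun a w b hab => ?_⟩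
  rcases List.infix_cons_iff.1 hab with hab' | hab
  · simp only [List.cons_prefix_cons] at hab'
    obtain ⟨rfl, rfl, t, rfl⟩ := hab'
    exact h b rfl
  · exact hp.2 a w b hab

/-- Following an open walk along its first, outgoing, edge either reaches an ancestor of `Z` or
never turns around. -/
theorem IsOpenWalk.mem_anc_or_transGen {v c : V} {l : List V} {z : V}
    (hp : D.IsOpenWalk Z (v :: c :: l)) (hvc : D.Edge v c)
    (hz : (c :: l).getLast? = some z) :
    v ∈ D.Anc Z ∨ Relation.TransGen D.Edge v z := by
  induction l generalizing v c with
  | nil =>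
    obtain rfl : c = z := by simpa using hz
    exact Or.inr (.single hvc)
  | cons d l ih =>
    have hp' : D.IsOpenWalk Z (c :: d :: l) := hp.subwalk (List.suffix_cons _ _).isInfix
    by_cases hdc : D.Edge d c
    · obtain ⟨w, hw, h⟩ := (hp.2 v c d ⟨[], l, rfl⟩).1 ⟨hvc, hdc⟩
      exact Or.inl ⟨w, hw, .head hvc h⟩
    · have hcd : D.Edge c d := (List.isChain_cons_cons.1 hp'.1).1.resolve_right hdc
      rcases ih hp' hcd (by simpa using hz) with ⟨w, hw, h⟩ | h
      · exact Or.inl ⟨w, hw, .head hvc h⟩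
      · exact Or.inr (.head hvc h)

theorem infix_triple_append_cons {α : Type*} {a w b v : α} {l l' : List α}
    (h : [a, w, b] <:+: l ++ v :: l') :
    [a, w, b] <:+: l ++ [v] ∨ [a, w, b] <:+: v :: l' ∨
      (w = v ∧ (∃ s, l = s ++ [a]) ∧ ∃ t, l' = b :: t) := by
  induction l with
  | nil => exact Or.inr (Or.inl h)
  | cons c l ih =>
    rw [List.cons_append, List.infix_cons_iff] at h
    rcases h with h | h
    · rw [List.cons_prefix_cons] at h
      obtain ⟨rfl, h⟩ := h
      rcases l with _ | ⟨d, l⟩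
      · simp only [List.nil_append, List.cons_prefix_cons] at h
        obtain ⟨rfl, t, rfl⟩ := h
        exact Or.inr (Or.inr ⟨rfl, ⟨[], rfl⟩, t, rfl⟩)
      · rw [List.cons_append, List.cons_prefix_cons] at h
        obtain ⟨rfl, h⟩ := h
        left
        rcases l with _ | ⟨e, l⟩
        · simp only [List.nil_append, List.cons_prefix_cons] at h
          obtain ⟨rfl, -⟩ := h
          exact ⟨[], [], rfl⟩
        · simp only [List.cons_append, List.cons_prefix_cons] at h
          obtain ⟨rfl, -⟩ := h
          exact ⟨[], l ++ [v], by simp⟩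
    · rcases ih h with h | h | ⟨rfl, ⟨s, rfl⟩, t, rfl⟩
      · exact Or.inl (h.trans (List.suffix_cons _ _).isInfix)
      · exact Or.inr (Or.inl h)
      · exact Or.inr (Or.inr ⟨rfl, ⟨c :: s, rfl⟩, t, rfl⟩)

theorem exists_eq_append_of_not_nodup {α : Type*} {p : List α} (h : ¬ p.Nodup) :
    ∃ v l₁ l₂ l₃, p = l₁ ++ v :: (l₂ ++ v :: l₃) := by
  induction p with
  | nil => simp at h
  | cons c p ih =>
    by_cases hc : c ∈ p
    · obtain ⟨s, t, rfl⟩ := List.append_of_mem hc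
      exact ⟨c, [], s, t, rfl⟩
    · obtain ⟨v, l₁, l₂, l₃, rfl⟩ := ih fun hp => h (List.nodup_cons.2 ⟨hc, hp⟩)
      exact ⟨v, c :: l₁, l₂, l₃, rfl⟩

/-- Cutting a closed detour out of an open walk leaves an open walk. -/
theorem IsOpenWalk.cut {v : V} {l₁ l₂ l₃ : List V}
    (hp : D.IsOpenWalk Z (l₁ ++ v :: (l₂ ++ v :: l₃))) :
    D.IsOpenWalk Z (l₁ ++ v :: l₃) := by
  have i1 : l₁ ++ [v] <:+: l₁ ++ v :: (l₂ ++ v :: l₃) := ⟨[], l₂ ++ v :: l₃, by simp⟩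
  have i2 : v :: (l₂ ++ [v]) <:+: l₁ ++ v :: (l₂ ++ v :: l₃) := ⟨l₁, l₃, by simp⟩
  have i3 : v :: l₃ <:+: l₁ ++ v :: (l₂ ++ v :: l₃) := ⟨l₁ ++ v :: l₂, [], by simp⟩
  refine ⟨?_, fun a w b h => ?_⟩
  · rw [← List.singleton_append, ← List.append_assoc]
    refine List.IsChain.append_overlap (l₂ := [v]) ?_ ?_ (by simp)
    · exact (hp.subwalk i1).1
    · exact (hp.subwalk i3).1
  rcases infix_triple_append_cons h with h | h | ⟨rfl, ⟨s, rfl⟩, t, rfl⟩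
  · exact hp.2 a w b (h.trans i1)
  · exact hp.2 a w b (h.trans i3)
  obtain ⟨c, m, hcm⟩ : ∃ c m, l₂ ++ [w] = c :: m := List.exists_cons_of_ne_nil (by simp)
  have hcw : D.OpenAt Z a w c := hp.2 a w c
    ⟨s, m ++ b :: t, by
      have : l₂ ++ w :: b :: t = (l₂ ++ [w]) ++ b :: t := by simp
      rw [this, hcm]; simp⟩
  obtain ⟨d, hdw⟩ : ∃ d, D.OpenAt Z d w b := by
    rcases List.eq_nil_or_concat l₂ with rfl | ⟨m', d, rfl⟩
    · exact ⟨w, hp.2 w w b ⟨s ++ [a], t, by simp⟩⟩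
    · exact ⟨d, hp.2 d w b ⟨s ++ [a, w] ++ m', t, by simp⟩⟩
  refine ⟨fun ⟨haw, hbw⟩ => ?_, fun hn hwZ => hn ?_⟩
  · by_cases hcw' : D.Edge c w
    · exact hcw.1 ⟨haw, hcw'⟩
    · have hloop := hp.subwalk i2
      rw [hcm] at hloop
      have hwc : D.Edge w c := (List.isChain_cons_cons.1 hloop.1).1.resolve_right hcw'
      exact (hloop.mem_anc_or_transGen hwc (by rw [← hcm]; simp)).resolve_right (D.acyclic w)
  · exact ⟨(not_not.1 fun h => hcw.2 h hwZ).1, (not_not.1 fun h => hdw.2 h hwZ).2⟩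

/-- An open walk between two sets can be shortened to a proper path. -/
theorem IsOpenWalk.exists_proper_path {p : List V} (hp : D.IsOpenWalk Z p)
    {x y : V} (hx : x ∈ X) (hy : y ∈ Y) (hpx : p.head? = some x) (hpy : p.getLast? = some y) :
    ∃ q, D.IsOpenWalk Z q ∧ (∃ x ∈ X, ∃ y ∈ Y, D.IsPathFrom q x y) ∧ ∀ v ∈ q.tail, v ∉ X := by
  induction hn : p.length using Nat.strong_induction_on generalizing p x with
  | _ n ih =>
    subst hn
    by_cases hnd : p.Nodup
    · by_cases hprop : ∀ v ∈ p.tail, v ∉ X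
      · exact ⟨p, hp, ⟨x, hx, y, hy, hnd, hp.1, hpx, hpy⟩, hprop⟩
      · push Not at hprop
        obtain ⟨v, hv, hvX⟩ := hprop
        obtain ⟨c, p, rfl⟩ :=
          List.exists_cons_of_ne_nil (List.ne_nil_of_mem (List.mem_of_mem_tail hv))
        obtain ⟨s, t, rfl⟩ := List.append_of_mem hv
        refine ih _ ?_ (hp.subwalk (q := v :: t) ⟨c :: s, [], by simp⟩) hvX rfl ?_ rfl
        · simp
        · rw [← hpy]
          have : c :: (s ++ v :: t) = (c :: s) ++ v :: t := rfl
          rw [this, List.getLast?_append]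
          simp [List.getLast?_cons]
    · obtain ⟨v, l₁, l₂, l₃, rfl⟩ := exists_eq_append_of_not_nodup hnd
      refine ih _ ?_ hp.cut hx ?_ ?_ rfl
      · simp
      · rw [← hpx]; cases l₁ <;> rfl
      · rw [← hpy]; simp [List.getLast?_append, List.getLast?_cons]

/-- Some open walk leads from `v` to `Y` without an initial edge into `v`. -/
def OutConnected (D : DAG V) (Y Z : Set V) (v : V) : Prop :=
  ∃ p, D.IsOpenWalk Z (v :: p) ∧ (∃ y ∈ Y, (v :: p).getLast? = some y) ∧
    ∀ u, p.head? = some u → D.Edge v u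

/-- Some open walk leads from `v` to `Y` with an initial edge into `v`. -/
def InConnected (D : DAG V) (Y Z : Set V) (v : V) : Prop :=
  ∃ u p, D.IsOpenWalk Z (v :: u :: p) ∧ (∃ y ∈ Y, (v :: u :: p).getLast? = some y) ∧
    D.Edge u v

theorem OutConnected.child {v c : V} (h : D.OutConnected Y Z v) (hv : v ∉ Z)
    (hvc : D.Edge v c) : D.InConnected Y Z c := by
  obtain ⟨p, hp, ⟨y, hy, hl⟩, -⟩ := h
  refine ⟨v, p, hp.cons (Or.inr hvc) fun u _ => ⟨fun h => ?_, fun _ => hv⟩,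
    ⟨y, hy, by simpa using hl⟩, hvc⟩
  exact absurd h.1 (D.edge_asymm hvc)

theorem OutConnected.parent {v c : V} (h : D.OutConnected Y Z v) (hv : v ∉ Z)
    (hcv : D.Edge c v) : D.OutConnected Y Z c := by
  obtain ⟨p, hp, ⟨y, hy, hl⟩, hout⟩ := h
  refine ⟨v :: p, hp.cons (Or.inl hcv) fun u hu => ⟨fun h => ?_, fun _ => hv⟩,
    ⟨y, hy, by simpa using hl⟩, by simpa using hcv⟩
  exact absurd h.2 (D.edge_asymm (hout u hu))

theorem InConnected.child {v c : V} (h : D.InConnected Y Z v) (hv : v ∉ Z)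
    (hvc : D.Edge v c) : D.InConnected Y Z c := by
  obtain ⟨u, p, hp, ⟨y, hy, hl⟩, -⟩ := h
  refine ⟨v, u :: p, hp.cons (Or.inr hvc) fun u _ => ⟨fun h => ?_, fun _ => hv⟩,
    ⟨y, hy, by simpa using hl⟩, hvc⟩
  exact absurd h.1 (D.edge_asymm hvc)

theorem InConnected.parent {v c : V} (h : D.InConnected Y Z v) (hv : v ∈ D.Anc Z)
    (hcv : D.Edge c v) : D.OutConnected Y Z c := by
  obtain ⟨u, p, hp, ⟨y, hy, hl⟩, huv⟩ := h
  refine ⟨v :: u :: p, hp.cons (Or.inl hcv) fun u' hu => ⟨fun _ => hv, fun h => ?_⟩,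
    ⟨y, hy, by simpa using hl⟩, by simpa using hcv⟩
  obtain rfl : u = u' := by simpa using hu
  exact absurd ⟨hcv, huv⟩ h

theorem outConnected_of_reflTransGen {v y : V} (hy : y ∈ Y) (hv : v ∉ D.Anc Z)
    (h : Relation.ReflTransGen D.Edge v y) : D.OutConnected Y Z v := by
  induction h using Relation.ReflTransGen.head_induction_on with
  | refl => exact ⟨[], isOpenWalk_singleton y, ⟨y, hy, rfl⟩, by simp⟩
  | head hvc _ ih =>
    have hc : _ ∉ D.Anc Z := fun hc => hv (D.isAncestral_anc Z _ hc hvc)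
    exact (ih hc).parent (fun h => hc (D.subset_anc Z h)) hvc

theorem InConnected.of_reflTransGen {v t : V} (h : D.InConnected Y Z v) (hv : v ∉ D.Anc Z)
    (hvt : Relation.ReflTransGen D.Edge v t) : D.InConnected Y Z t := by
  induction hvt with
  | refl => exact h
  | tail hvb hbc ih =>
    exact ih.child (fun hb => hv ⟨_, hb, hvb⟩) hbc

theorem family_subset_of_no_open_walk
    (hX : ∀ x ∈ X, ¬ D.OutConnected Y Z x ∧ ¬ D.InConnected Y Z x)
    {i : V} (hi : i ∈ D.Anc (X ∪ Y ∪ Z))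
    (h : (D.family i ∩ {v | v ∉ Z ∧ (D.OutConnected Y Z v ∨ D.InConnected Y Z v)}).Nonempty) :
    D.family i ⊆ {v | v ∉ Z ∧ (D.OutConnected Y Z v ∨ D.InConnected Y Z v)} ∪ Z := by
  have parents : ∀ w, D.Edge w i → ((i ∉ Z ∧ D.OutConnected Y Z i) ∨ D.InConnected Y Z i) →
      D.OutConnected Y Z w := by
    rintro w hw (⟨hiZ, hout⟩ | hin)
    · exact hout.parent hiZ hw
    · by_cases hiZ : i ∈ D.Anc Z
      · exact hin.parent hiZ hw
      · obtain ⟨t, (ht | ht) | ht, hit⟩ := hi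
        · exact absurd (hin.of_reflTransGen hiZ hit) (hX t ht).2
        · exact (outConnected_of_reflTransGen ht hiZ hit).parent
            (fun h => hiZ (D.subset_anc Z h)) hw
        · exact absurd ⟨t, ht, hit⟩ hiZ
  have mem : ∀ w, (w ∉ Z → D.OutConnected Y Z w ∨ D.InConnected Y Z w) →
      w ∈ {v | v ∉ Z ∧ (D.OutConnected Y Z v ∨ D.InConnected Y Z v)} ∪ Z := by
    intro w hw
    by_cases hwZ : w ∈ Z
    exacts [Or.inr hwZ, Or.inl ⟨hwZ, hw hwZ⟩]
  obtain ⟨u, hu, huZ, hconn⟩ := h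
  rcases hu with rfl | hu
  · rintro w (rfl | hw)
    · exact mem _ fun _ => hconn
    · exact mem _ fun _ => Or.inl (parents w hw (hconn.imp_left fun h => ⟨huZ, h⟩))
  · have hin : D.InConnected Y Z i := hconn.elim (fun h => h.child huZ hu) (fun h => h.child huZ hu)
    rintro w (rfl | hw)
    · exact mem _ fun _ => Or.inr hin
    · exact mem _ fun _ => Or.inl (parents w hw (Or.inr hin))

/-- The global Markov property: if no proper path from `X` to `Y` is open given `Z`, then `X` and
`Y` are conditionally independent given `Z`. -/
theorem IsKernelFamily.marg_mul_marg {A : Type} [Fintype A] [DecidableEq A]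
    {K : V → (V → A) → ℝ} (hK : D.IsKernelFamily K) (hYZ : Disjoint Y Z)
    (hsep : ∀ p, D.IsOpenWalk Z p → (∃ x ∈ X, ∃ y ∈ Y, D.IsPathFrom p x y) →
      ¬ ∀ v ∈ p.tail, v ∉ X) (v : V → A) :
    marg (fun w => ∏ i, K i w) (Y ∪ (X ∪ Z)) v * marg (fun w => ∏ i, K i w) Z v =
      marg (fun w => ∏ i, K i w) (X ∪ Z) v * marg (fun w => ∏ i, K i w) (Y ∪ Z) v := by
  have hX : ∀ x ∈ X, ¬ D.OutConnected Y Z x ∧ ¬ D.InConnected Y Z x := by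
    refine fun x hx => ⟨?_, ?_⟩
    · rintro ⟨p, hp, ⟨y, hy, hl⟩, -⟩
      obtain ⟨q, hq, hq', hq''⟩ := hp.exists_proper_path hx hy rfl hl
      exact hsep q hq hq' hq''
    · rintro ⟨u, p, hp, ⟨y, hy, hl⟩, -⟩
      obtain ⟨q, hq, hq', hq''⟩ := hp.exists_proper_path hx hy rfl hl
      exact hsep q hq hq' hq''
  have hsub := D.subset_anc (X ∪ Y ∪ Z)
  refine hK.marg_mul_marg_of_cut (D.isAncestral_anc (X ∪ Y ∪ Z))
    (fun j h => hsub (Or.inl (Or.inl h))) (fun j h => hsub (Or.inl (Or.inr h)))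
    (fun j h => hsub (Or.inr h)) ?_ ?_ (fun i hi h => family_subset_of_no_open_walk hX hi h) v
  · exact Set.disjoint_left.2 fun x hx h => h.2.elim (hX x hx).1 (hX x hx).2
  · exact fun y hy => ⟨Set.disjoint_left.1 hYZ hy,
      Or.inl ⟨[], isOpenWalk_singleton y, ⟨y, hy, rfl⟩, by simp⟩⟩

end Walks

section Adjustment

/-- The nodes outside `X` on proper causal paths from `X` to `Y`. -/
def properCausalNodes (D : DAG V) (X Y : Set V) : Set V :=
  {w | w ∉ X ∧ ∃ p, D.ProperCausalPath X Y p ∧ w ∈ p}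

/-- The proper back-door graph: `D` without the first edges of proper causal paths. -/
def properBackdoorGraph (D : DAG V) (X Y : Set V) : DAG V where
  Edge a b := D.Edge a b ∧ ¬ (a ∈ X ∧ b ∈ D.properCausalNodes X Y)
  acyclic v h := D.acyclic v (Relation.TransGen.mono (fun _ _ h => h.1) v v h)

variable {D : DAG V} {X Y Z : Set V}

theorem isAncestral_compl_forb (D : DAG V) (X Y : Set V) : D.IsAncestral (D.Forb X Y)ᶜ := by
  rintro i hi j hj ⟨p, w, hp, hw, hwX, h⟩
  exact hi ⟨p, w, hp, hw, hwX, .tail h hj⟩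

theorem properCausalNodes_subset_forb (D : DAG V) (X Y : Set V) :
    D.properCausalNodes X Y ⊆ D.Forb X Y := by
  rintro w ⟨hwX, p, hp, hw⟩
  exact ⟨p, w, hp, hw, hwX, .refl⟩

theorem IsCausal.nodup {p : List V} (hp : D.IsCausal p) : p.Nodup := by
  have h : p.IsChain (Relation.TransGen D.Edge) :=
    List.IsChain.imp (fun _ _ h => Relation.TransGen.single h) hp
  rw [List.isChain_iff_pairwise] at h
  refine h.imp fun {a b} hab => ?_
  rintro rfl
  exact D.acyclic _ hab

theorem exists_causal_list {Y : Set V} {v : V} (hv : v ∈ (D.properBackdoorGraph X Y).Anc Y)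
    (hXY : Disjoint X Y) : v ∉ X ∧ ∃ y ∈ Y, ∃ p, D.IsCausal (v :: p) ∧
      (v :: p).getLast? = some y ∧ ∀ u ∈ v :: p, u ∉ X := by
  obtain ⟨y, hy, h⟩ := hv
  induction h using Relation.ReflTransGen.head_induction_on with
  | refl =>
    have hyX : y ∉ X := fun h => Set.disjoint_left.1 hXY h hy
    exact ⟨hyX, y, hy, [], List.IsChain.singleton y, rfl, by simpa using hyX⟩
  | @head a c hac _ ih =>
    obtain ⟨hcX, y, hy, p, hp, hl, hpX⟩ := ih
    have hcausal : D.IsCausal (a :: c :: p) := List.isChain_cons_cons.2 ⟨hac.1, hp⟩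
    have haX : a ∉ X := by
      intro haX
      refine hac.2 ⟨haX, hcX, a :: c :: p, ⟨⟨a, haX, y, hy, hcausal.nodup, ?_, rfl, ?_⟩,
        hpX, hcausal⟩, by simp⟩
      · exact List.IsChain.imp (fun _ _ h => Or.inl h) hcausal
      · simpa using hl
    refine ⟨haX, y, hy, c :: p, hcausal, by simpa using hl, ?_⟩
    intro u hu
    rcases List.mem_cons.1 hu with rfl | hu
    exacts [haX, hpX u hu]

/-- The adjustment criterion implies separation in the proper back-door graph. -/
theorem SatisfiesAC.not_proper (hXY : Disjoint X Y) (hAC : D.SatisfiesAC X Y Z) {p : List V}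
    (hp : (D.properBackdoorGraph X Y).IsOpenWalk Z p)
    (hpath : ∃ x ∈ X, ∃ y ∈ Y, (D.properBackdoorGraph X Y).IsPathFrom p x y) :
    ¬ ∀ v ∈ p.tail, v ∉ X := by
  intro hprop
  obtain ⟨x, hx, y, hy, hnd, -, hpx, hpy⟩ := hpath
  have hadj : p.IsChain D.Adj :=
    List.IsChain.imp (fun _ _ h => h.imp (fun h => h.1) fun h => h.1) hp.1
  have hD : ∃ x ∈ X, ∃ y ∈ Y, D.IsPathFrom p x y := ⟨x, hx, y, hy, hnd, hadj, hpx, hpy⟩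
  by_cases hc : D.IsCausal p
  · rcases p with _ | ⟨x', _ | ⟨w, p⟩⟩
    · simp at hpx
    · obtain rfl : x' = x := by simpa using hpx
      obtain rfl : x' = y := by simpa using hpy
      exact Set.disjoint_left.1 hXY hx hy
    · obtain rfl : x' = x := by simpa using hpx
      have hxw : D.Edge x' w := (List.isChain_cons_cons.1 hc).1
      rcases (List.isChain_cons_cons.1 hp.1).1 with h | h
      · exact h.2 ⟨hx, hprop w (by simp), _, ⟨hD, hprop, hc⟩, by simp⟩
      · exact D.edge_asymm hxw h.1
  · have hedge : ∀ a w b, [a, w, b] <:+: p →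
        ((D.properBackdoorGraph X Y).Edge a w ↔ D.Edge a w) ∧
        ((D.properBackdoorGraph X Y).Edge b w ↔ D.Edge b w) := by
      intro a w b h
      have hch := (hp.subwalk h).1
      simp only [List.isChain_cons_cons] at hch
      refine ⟨⟨fun h => h.1, fun h => ?_⟩, ⟨fun h => h.1, fun h => ?_⟩⟩
      · exact hch.1.resolve_right fun h' => D.edge_asymm h h'.1
      · exact hch.2.1.resolve_left fun h' => D.edge_asymm h h'.1
    rcases hAC.2 p ⟨hD, hprop, hc⟩ with ⟨w, ⟨⟨a, b, hab⟩, hncol⟩, hwZ⟩ |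
        ⟨w, ⟨a, b, hab, haw, hbw⟩, hdesc⟩
    · refine (hp.2 a w b hab).2 (fun h => hncol ⟨a, b, hab, ?_, ?_⟩) hwZ
      exacts [h.1.1, h.2.1]
    · obtain ⟨z, hz, h⟩ := (hp.2 a w b hab).1
        ⟨(hedge a w b hab).1.2 haw, (hedge a w b hab).2.2 hbw⟩
      have : z ∈ D.Desc {w} ∩ Z :=
        ⟨⟨w, rfl, Relation.ReflTransGen.mono (fun _ _ h => h.1) w z h⟩, hz⟩
      rw [hdesc] at this
      exact this

variable {A : Type} [Fintype A] [DecidableEq A]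

/-- The kernels of `D` in which nodes on proper causal paths read `a` instead of the actual
values on `X`. -/
noncomputable def edgeInterventionKernel (D : DAG V) (X Y : Set V) (K : V → (V → A) → ℝ)
    (a : V → A) (i : V) (v : V → A) : ℝ :=
  if i ∈ D.properCausalNodes X Y then K i (resetOn X a v) else K i v

theorem IsKernelFamily.edgeIntervention {K : V → (V → A) → ℝ} (hK : D.IsKernelFamily K)
    (a : V → A) :
    (D.properBackdoorGraph X Y).IsKernelFamily (D.edgeInterventionKernel X Y K a) where
  local_family i v w h := by
    unfold edgeInterventionKernel
    split_ifs with hi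
    · refine hK.local_family i _ _ fun j hj => ?_
      unfold resetOn
      split_ifs with hjX
      · rfl
      · exact h j (hj.imp id fun hj => ⟨hj, fun h => hjX h.1⟩)
    · exact hK.local_family i _ _ fun j hj => h j (hj.imp id fun hj => ⟨hj, fun h => hi h.2⟩)
  sum_update i v := by
    unfold edgeInterventionKernel
    split_ifs with hi
    · simp_rw [resetOn_update hi.1]
      exact hK.sum_update i _
    · exact hK.sum_update i v

/-- The kernels of the do-intervention: a point mass at `a` on `X`, and the edge-intervention
kernels elsewhere. -/
noncomputable def doKernel (D : DAG V) (X Y : Set V) (K : V → (V → A) → ℝ)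
    (a : V → A) (i : V) (v : V → A) : ℝ :=
  if i ∈ X then (if v i = a i then 1 else 0) else D.edgeInterventionKernel X Y K a i v

theorem IsKernelFamily.doKernel {K : V → (V → A) → ℝ} (hK : D.IsKernelFamily K)
    (a : V → A) :
    (D.properBackdoorGraph X Y).IsKernelFamily (D.doKernel X Y K a) where
  local_family i v w h := by
    unfold DAG.doKernel
    split_ifs with hi h1 h2 h2
    · rfl
    · exact absurd ((h i (Or.inl rfl)).symm.trans h1) h2
    · exact absurd ((h i (Or.inl rfl)).trans h2) h1
    · rfl
    · exact (hK.edgeIntervention a).local_family i v w h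
  sum_update i v := by
    unfold DAG.doKernel
    split_ifs with hi
    · simp
    · exact (hK.edgeIntervention a).sum_update i v

theorem edgeInterventionKernel_eq {K : V → (V → A) → ℝ} {a v : V → A}
    (h : ∀ i ∈ X, v i = a i) (i : V) : D.edgeInterventionKernel X Y K a i v = K i v := by
  unfold edgeInterventionKernel
  rw [resetOn_eq_self h, ite_self]

theorem doPMF_eq_prod (f : (V → A) → ℝ) (a : V → A) :
    D.doPMF f X a =
      fun v => ∏ i, D.doKernel X Y (fun i => condP f {i} (D.parents i)) a i v := by
  funext v
  unfold doPMF
  split_ifs with h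
  · refine Finset.prod_congr rfl fun i _ => ?_
    unfold DAG.doKernel
    split_ifs with hi hv
    · rfl
    · exact absurd (h i hi) hv
    · rw [edgeInterventionKernel_eq h]
  · push Not at h
    obtain ⟨i, hi, hv⟩ := h
    refine (Finset.prod_eq_zero (Finset.mem_univ i) ?_).symm
    unfold DAG.doKernel
    rw [if_pos hi, if_neg hv]

theorem marg_doPMF {f : (V → A) → ℝ} (hf : ∀ v, 0 < f v) (hXY : Disjoint X Y) (a : V → A)
    (v : V → A) :
    marg (D.doPMF f X a) Y v = marg (fun w => ∏ i,
      D.edgeInterventionKernel X Y (fun i => condP f {i} (D.parents i)) a i w) Y v := by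
  have hK := IsKernelFamily.condP D hf
  rw [doPMF_eq_prod (Y := Y)]
  refine marg_congr_of_subset ((D.properBackdoorGraph X Y).subset_anc Y) (fun v => ?_) v
  rw [(hK.doKernel a).marg_prod (isAncestral_anc _ Y),
    (hK.edgeIntervention a).marg_prod (isAncestral_anc _ Y)]
  refine Finset.prod_congr rfl fun i _ => ?_
  split_ifs with hi
  · exact if_neg (exists_causal_list hi hXY).1
  · rfl

theorem marg_edgeIntervention_of_not_forb {f : (V → A) → ℝ} (hf : D.IsConsistent f)
    (hZ : Z ∩ D.Forb X Y = ∅) (a v : V → A) :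
    marg (fun w => ∏ i,
      D.edgeInterventionKernel X Y (fun i => condP f {i} (D.parents i)) a i w) Z v =
      marg f Z v := by
  have hK := IsKernelFamily.condP D hf.1
  have hfK : marg f (D.Forb X Y)ᶜ =
      marg (fun w => ∏ i, condP f {i} (D.parents i) w) (D.Forb X Y)ᶜ := by
    congr 1
    exact funext hf.2.2
  have hanc := isAncestral_compl_forb D X Y
  have hanc' : (D.properBackdoorGraph X Y).IsAncestral (D.Forb X Y)ᶜ :=
    fun i hi j hj => hanc i hi hj.1
  have hZ' : Z ⊆ (D.Forb X Y)ᶜ := fun z hz hz' => by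
    have : z ∈ Z ∩ D.Forb X Y := ⟨hz, hz'⟩
    rw [hZ] at this
    exact this
  refine marg_congr_of_subset hZ' (fun v => ?_) v
  rw [(hK.edgeIntervention a).marg_prod hanc', hfK, hK.marg_prod hanc]
  refine Finset.prod_congr rfl fun i _ => ?_
  split_ifs with hi
  · exact if_neg fun h => hi (D.properCausalNodes_subset_forb X Y h)
  · rfl

theorem marg_edgeIntervention_of_subset {f : (V → A) → ℝ} (hf : D.IsConsistent f)
    {S : Set V} (hS : X ⊆ S) {a v : V → A} (hv : ∀ i ∈ X, v i = a i) :
    marg (fun w => ∏ i,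
      D.edgeInterventionKernel X Y (fun i => condP f {i} (D.parents i)) a i w) S v =
      marg f S v := by
  unfold marg
  refine Finset.sum_congr rfl fun w _ => ?_
  split_ifs with h
  · have hw : ∀ i ∈ X, w i = a i := fun i hi => (h i (hS hi)).trans (hv i hi)
    rw [hf.2.2 w]
    exact Finset.prod_congr rfl fun i _ => edgeInterventionKernel_eq hw i
  · rfl

theorem SatisfiesAC.marg_doPMF_eq_adjFormula (hXY : Disjoint X Y) (hXZ : Disjoint X Z)
    (hYZ : Disjoint Y Z) (hAC : D.SatisfiesAC X Y Z) {f : (V → A) → ℝ} (hf : D.IsConsistent f)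
    (a : V → A) : marg (D.doPMF f X a) Y a = adjFormula f X Y Z a := by
  have hK := (IsKernelFamily.condP D hf.1).edgeIntervention (X := X) (Y := Y) a
  have hdiff : (Y ∪ Z) \ Y = Z := by
    rw [Set.union_sdiff_left]; exact hYZ.symm.sdiff_eq_left
  rw [marg_doPMF hf.1 hXY, ← marg_marg _ (Set.subset_union_left (s := Y) (t := Z)), hdiff]
  unfold adjFormula
  rw [marg]
  refine Finset.sum_congr rfl fun w _ => ?_
  refine ite_eq_ite_of_iff Iff.rfl fun hw => ?_
  have hwX : ∀ i ∈ X, w i = a i := fun i hi => hw i (Set.disjoint_left.1 hXZ hi)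
  have hci := hK.marg_mul_marg hYZ (fun p hp hp' => hAC.not_proper hXY hp hp') w
  rw [marg_edgeIntervention_of_subset hf (S := Y ∪ (X ∪ Z)) (fun i hi => Or.inr (Or.inl hi)) hwX,
    marg_edgeIntervention_of_subset hf Set.subset_union_left hwX,
    marg_edgeIntervention_of_not_forb hf hAC.1] at hci
  have hpos := marg_pos hf.1 (X ∪ Z) w
  rw [condP.eq_1 f Y, div_mul_eq_mul_div, hci, mul_div_cancel_left₀ _ hpos.ne']

theorem adjFormula_empty {f : (V → A) → ℝ} (hf : ∑ v, f v = 1) (a : V → A) :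
    adjFormula f X Y ∅ a = condP f Y X a := by
  unfold adjFormula
  rw [Finset.sum_eq_single a]
  · simp [marg, hf]
  · intro w _ hw
    rw [if_neg]
    exact fun h => hw (funext fun i => h i (Set.notMem_empty i))
  · simp

end Adjustment

end DAG

open DAG in
/-- If `Z` satisfies the adjustment criterion relative to `(X, Y)` in
the DAG `D`, then for every strictly positive joint pmf consistent with `D` and all
assignments (encoded as one full assignment `a`, read on `X`, `Y` and `Z`):
`f(y | do(x)) = f(y | x)` when `Z = ∅`, and `f(y | do(x)) = ∑_z f(y | x, z) f(z)`
otherwise; that is, `Z` is an adjustment set relative to `(X, Y)` in `D`. -/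
theorem adjustment_criterion_sound
    {V : Type} [Fintype V] [DecidableEq V] {A : Type} [Fintype A] [DecidableEq A]
    (hcard : 2 ≤ Fintype.card A)
    (D : DAG V) (X Y Z : Set V)
    (hXY : Disjoint X Y) (hXZ : Disjoint X Z) (hYZ : Disjoint Y Z)
    (hX : X.Nonempty) (hY : Y.Nonempty)
    (hAC : D.SatisfiesAC X Y Z) :
    ∀ f : (V → A) → ℝ, D.IsConsistent f → ∀ a : V → A,
      (Z = ∅ → marg (D.doPMF f X a) Y a = condP f Y X a) ∧
      (Z ≠ ∅ → marg (D.doPMF f X a) Y a = adjFormula f X Y Z a) := by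
  intro f hf a
  have key := hAC.marg_doPMF_eq_adjFormula hXY hXZ hYZ hf a
  refine ⟨?_, fun _ => key⟩
  rintro rfl
  rw [key, adjFormula_empty hf.2.1]
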